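/- Let G be a locally finite, connected metric graph with finite total length L > 0, let y be a point of the completion of G (a vertex or an end), and let f be a function in H^1(G) vanishing at y that is C^1 on each closed edge. Then ∫_G |f'(x)|² dx ≥ (π²/(4L²)) ∫_G |f(x)|² dx. Equality holds for a nonzero f if and only if G is isometrically isomorphic to an interval with y as one of its endpoints and f is proportional to sin(πs/(2L)), where s denotes the distance to y. -/

import Mathlib

open MeasureTheory Set Filter
open scoped ENNReal

/-- A metric graph structure on a metric space `X`: a countable collection of edges,
each parametrised by arc length over `[0, len e]`, together with vertices identified
with edge endpoints; the interiors of distinct edges are disjoint, the edges cover `X`,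
and the metric of `X` is the induced path metric (characterised by the fact that the
edge parametrisations are `1`-Lipschitz and `dist x y` is the largest value `u x - u y`
over all continuous, edgewise `1`-Lipschitz functions `u : X → ℝ`). -/
structure MetricGraphOn (X : Type) [MetricSpace X] where
  V : Type
  E : Type
  countableV : Countable V
  countableE : Countable E
  len : E → ℝ
  len_pos : ∀ e, 0 < len e
  edgeMap : E → ℝ → X
  vertexMap : V → X
  endpoint : E → Bool → V
  edgeMap_cont : ∀ e, ContinuousOn (edgeMap e) (Icc 0 (len e))
  edgeMap_injOn : ∀ e, InjOn (edgeMap e) (Ico 0 (len e))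
  edgeMap_zero : ∀ e, edgeMap e 0 = vertexMap (endpoint e false)
  edgeMap_len : ∀ e, edgeMap e (len e) = vertexMap (endpoint e true)
  interior_disjoint : ∀ e e', e ≠ e' → ∀ s ∈ Ioo 0 (len e), ∀ t ∈ Ioo 0 (len e'),
    edgeMap e s ≠ edgeMap e' t
  interior_not_vertex : ∀ e, ∀ s ∈ Ioo 0 (len e), ∀ v, edgeMap e s ≠ vertexMap v
  vertexMap_inj : Function.Injective vertexMap
  cover : ∀ x : X, ∃ e, ∃ t ∈ Icc 0 (len e), edgeMap e t = x
  dist_le : ∀ e, ∀ s ∈ Icc 0 (len e), ∀ t ∈ Icc 0 (len e),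
    dist (edgeMap e s) (edgeMap e t) ≤ |s - t|
  dist_ge : ∀ u : X → ℝ, Continuous u →
    (∀ e, ∀ s ∈ Icc 0 (len e), ∀ t ∈ Icc 0 (len e),
      |u (edgeMap e s) - u (edgeMap e t)| ≤ |s - t|) →
    ∀ x y, u x - u y ≤ dist x y

namespace MetricGraphOn

variable {X : Type} [MetricSpace X]

/-- The (a.e. defined) derivative of `f` along the edge `e`, in the arc-length
parametrisation of the edge. -/
noncomputable def edgeDeriv (G : MetricGraphOn X) (f : X → ℝ) (e : G.E) : ℝ → ℝ :=
  deriv (f ∘ G.edgeMap e)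

/-- The subset of `X` consisting of the (closed) edges in `A`. -/
def subgraphSet (G : MetricGraphOn X) (A : Set G.E) : Set X :=
  ⋃ e ∈ A, G.edgeMap e '' Icc 0 (G.len e)

/-- `∫_e |f|²` along a single edge. -/
noncomputable def edgeMass (G : MetricGraphOn X) (f : X → ℝ) (e : G.E) : ℝ :=
  ∫ t in Ioo 0 (G.len e), (f (G.edgeMap e t)) ^ 2

/-- `∫_e |f'|²` along a single edge. -/
noncomputable def edgeEnergy (G : MetricGraphOn X) (f : X → ℝ) (e : G.E) : ℝ :=
  ∫ t in Ioo 0 (G.len e), (G.edgeDeriv f e t) ^ 2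

/-- Membership in the Sobolev space `H¹` of the subgraph given by the edge set `A`:
continuity on the subgraph, edgewise absolute continuity with square-integrable
derivative, and finiteness of the total `H¹` norm. -/
def MemH1On (G : MetricGraphOn X) (A : Set G.E) (f : X → ℝ) : Prop :=
  ContinuousOn f (G.subgraphSet A) ∧
  (∀ e ∈ A, IntegrableOn (fun t => (G.edgeDeriv f e t) ^ 2) (Ioo 0 (G.len e))) ∧
  (∀ e ∈ A, ∀ t ∈ Icc (0:ℝ) (G.len e),
    f (G.edgeMap e t) = f (G.edgeMap e 0) + ∫ s in Ioo 0 t, G.edgeDeriv f e s) ∧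
  Summable (fun e : A => G.edgeMass f (e : G.E) + G.edgeEnergy f (e : G.E))

/-- Membership in `H¹(G)`. -/
def MemH1 (G : MetricGraphOn X) (f : X → ℝ) : Prop :=
  Continuous f ∧ G.MemH1On Set.univ f

/-- The squared `L²` norm of `f` over the edges in `A`. -/
noncomputable def l2normSqOn (G : MetricGraphOn X) (A : Set G.E) (f : X → ℝ) : ℝ :=
  ∑' e : A, G.edgeMass f (e : G.E)

/-- The squared `L²` norm of `f'` over the edges in `A`. -/
noncomputable def derivNormSqOn (G : MetricGraphOn X) (A : Set G.E) (f : X → ℝ) : ℝ :=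
  ∑' e : A, G.edgeEnergy f (e : G.E)

/-- The squared `L²` norm of `f` on `G`. -/
noncomputable def l2normSq (G : MetricGraphOn X) (f : X → ℝ) : ℝ :=
  G.l2normSqOn Set.univ f

/-- The squared `L²` norm of `f'` on `G` (the Dirichlet energy of `f`). -/
noncomputable def derivNormSq (G : MetricGraphOn X) (f : X → ℝ) : ℝ :=
  G.derivNormSqOn Set.univ f

/-- The squared `H¹` norm of `f`. -/
noncomputable def h1normSq (G : MetricGraphOn X) (f : X → ℝ) : ℝ :=
  G.l2normSq f + G.derivNormSq f

/-- The `L²` inner product on `G`. -/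
noncomputable def l2inner (G : MetricGraphOn X) (f g : X → ℝ) : ℝ :=
  ∑' e : G.E, ∫ t in Ioo 0 (G.len e), f (G.edgeMap e t) * g (G.edgeMap e t)

/-- The Dirichlet form (inner product of derivatives) on `G`. -/
noncomputable def derivInner (G : MetricGraphOn X) (f g : X → ℝ) : ℝ :=
  ∑' e : G.E, ∫ t in Ioo 0 (G.len e), G.edgeDeriv f e t * G.edgeDeriv g e t

/-- The `k`-th min-max (Courant–Fischer) value of the quadratic form
`f ↦ ∫ |f'|²` (over the edges of `A`) with form domain `K`: the infimum over all
`k`-dimensional subspaces of `K` of the largest Rayleigh quotient on the subspace.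
For a self-adjoint Laplacian with purely discrete spectrum this is its `k`-th
eigenvalue (`k = 1` giving the lowest one). -/
noncomputable def eigenOn (G : MetricGraphOn X) (A : Set G.E) (K : Set (X → ℝ))
    (k : ℕ) : ℝ :=
  sInf { μ : ℝ | ∃ φ : Fin k → X → ℝ, (∀ i, φ i ∈ K) ∧
    LinearIndependent ℝ (fun i => (G.subgraphSet A).restrict (φ i)) ∧
    ∀ c : Fin k → ℝ,
      G.derivNormSqOn A (∑ i, c i • φ i) ≤ μ * G.l2normSqOn A (∑ i, c i • φ i) }

/-- The `k`-th eigenvalue `μ_k(G)` of the Neumann extension (standard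
continuity–Kirchhoff conditions at all vertices, Neumann conditions at all ends). -/
noncomputable def neumannEigen (G : MetricGraphOn X) (k : ℕ) : ℝ :=
  G.eigenOn Set.univ {f | G.MemH1 f} k

/-- `f` vanishes at the point `y` of the completion of `X`. -/
def VanishesAt (f : X → ℝ) (y : UniformSpace.Completion X) : Prop :=
  Tendsto f (comap ((↑) : X → UniformSpace.Completion X) (nhds y)) (nhds 0)

/-- Membership in `H¹₀(G; 𝔙)`: `H¹`-functions vanishing on the set `𝔙` of
vertices and/or ends (viewed inside the completion of `X`). -/
def H10Mem (G : MetricGraphOn X) (𝔙 : Set (UniformSpace.Completion X))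
    (f : X → ℝ) : Prop :=
  G.MemH1 f ∧ ∀ y ∈ 𝔙, VanishesAt f y

/-- The `k`-th eigenvalue `λ_k(G; 𝔙)` of the Laplacian with Dirichlet conditions
on `𝔙` and standard (continuity–Kirchhoff/Neumann) conditions elsewhere. -/
noncomputable def dirichletEigen (G : MetricGraphOn X)
    (𝔙 : Set (UniformSpace.Completion X)) (k : ℕ) : ℝ :=
  G.eigenOn Set.univ {f | G.H10Mem 𝔙 f} k

/-- The set of (topological = graph) ends of `G`, realised as the points of the
completion of `X` that do not belong to `X`. -/
def Ends (_G : MetricGraphOn X) : Set (UniformSpace.Completion X) :=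
  {y | y ∉ Set.range ((↑) : X → UniformSpace.Completion X)}

/-- The set of vertices of `G`, viewed inside the completion of `X`. -/
def vertexPoints (G : MetricGraphOn X) : Set (UniformSpace.Completion X) :=
  Set.range (fun v => ((G.vertexMap v : X) : UniformSpace.Completion X))

/-- The degree of a vertex (loops counted twice). -/
noncomputable def degree (G : MetricGraphOn X) (v : G.V) : ℕ :=
  {p : G.E × Bool | G.endpoint p.1 p.2 = v}.ncard

/-- `G` is locally finite: every vertex has finite degree. -/
def LocallyFinite (G : MetricGraphOn X) : Prop :=
  ∀ v : G.V, {p : G.E × Bool | G.endpoint p.1 p.2 = v}.Finite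

/-- A cycle in `G`: a compact subset homeomorphic to a circle. -/
def IsCycle (_G : MetricGraphOn X) (C : Set X) : Prop :=
  IsCompact C ∧ Nonempty (C ≃ₜ Metric.sphere (0 : ℝ × ℝ) 1)

/-- `G` has (first) Betti number `β`: there is a minimal finite family of `β` cycles
whose union contains every cycle of `G`. -/
def HasBettiNumber (G : MetricGraphOn X) (β : ℕ) : Prop :=
  ∃ 𝒞 : Finset (Set X), 𝒞.card = β ∧ (∀ C ∈ 𝒞, G.IsCycle C) ∧
    (∀ C, G.IsCycle C → C ⊆ ⋃ C' ∈ 𝒞, C') ∧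
    ∀ 𝒞' : Finset (Set X), (∀ C ∈ 𝒞', G.IsCycle C) →
      (∀ C, G.IsCycle C → C ⊆ ⋃ C' ∈ 𝒞', C') → β ≤ 𝒞'.card

/-- The embedding of `K ⊆ H¹(G)` into `L²(G)` is compact: every sequence in `K`
bounded in the `H¹` norm has a subsequence which is Cauchy in the `L²` norm. -/
def CompactlyEmbedded (G : MetricGraphOn X) (K : Set (X → ℝ)) : Prop :=
  ∀ u : ℕ → X → ℝ, (∀ n, u n ∈ K) → (∀ n, G.h1normSq (u n) ≤ 1) →
    ∃ φ : ℕ → ℕ, StrictMono φ ∧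
      ∀ ε : ℝ, 0 < ε → ∃ N, ∀ m, N ≤ m → ∀ n, N ≤ n →
        G.l2normSq (u (φ m) - u (φ n)) ≤ ε

/-- The self-adjoint operator with form `f ↦ ∫ |f'|²` and form domain `K` has
purely discrete spectrum (equivalently, compact resolvent): its min-max values
tend to `+∞`. -/
def HasPurelyDiscreteSpectrumOn (G : MetricGraphOn X) (K : Set (X → ℝ)) : Prop :=
  Tendsto (fun k => G.eigenOn Set.univ K k) atTop atTop

/-- The volume (total length) of a subset `S` of `G`. -/
noncomputable def vol (G : MetricGraphOn X) (S : Set X) : ℝ≥0∞ :=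
  ∑' e : G.E, volume (G.edgeMap e ⁻¹' S ∩ Ioo 0 (G.len e))

/-- The set of vertices incident to some edge in `A`. -/
def vertexSetOf (G : MetricGraphOn X) (A : Set G.E) : Set G.V :=
  {v | ∃ e ∈ A, ∃ b, G.endpoint e b = v}

/-- Membership in `H¹₀(G)`, the closure in `H¹(G)` of the compactly supported
`H¹` functions (the form domain of the Friedrichs extension). -/
def H100Mem (G : MetricGraphOn X) (f : X → ℝ) : Prop :=
  G.MemH1 f ∧ ∃ u : ℕ → X → ℝ, (∀ n, G.MemH1 (u n) ∧ HasCompactSupport (u n)) ∧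
    Tendsto (fun n => G.h1normSq (f - u n)) atTop (nhds 0)

/-- The `k`-th eigenvalue `λ_k(G)` of the Friedrichs extension. -/
noncomputable def friedrichsEigen (G : MetricGraphOn X) (k : ℕ) : ℝ :=
  G.eigenOn Set.univ {f | G.H100Mem f} k

end MetricGraphOn

/-- `X` is isometrically isomorphic to an interval of length `L` with the point `y`
of its completion as one of its endpoints (located at coordinate `0`). -/
def IsIntervalWithEndpoint (X : Type) [MetricSpace X] (L : ℝ)
    (y : UniformSpace.Completion X) : Prop :=
  ∃ φ : X → ℝ, (∀ x x' : X, dist x x' = |φ x - φ x'|) ∧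
    Set.Ioo 0 L ⊆ Set.range φ ∧ Set.range φ ⊆ Set.Icc 0 L ∧
    Filter.Tendsto φ
      (Filter.comap ((↑) : X → UniformSpace.Completion X) (nhds y)) (nhds 0)

/-- Cutting a closed preconnected set along a level of a continuous function: the sublevel part
inherits preconnectedness as soon as the level consists of at most one point. -/
theorem isPreconnected_inter_preimage_Iic {X : Type*} [TopologicalSpace X] {T : Set X} {g : X → ℝ}
    {c : ℝ} (hT : IsPreconnected T) (hTc : IsClosed T) (hg : Continuous g)
    (hc : (g ⁻¹' {c}).Subsingleton) : IsPreconnected (T ∩ g ⁻¹' Iic c) := by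
  have hS : IsClosed (T ∩ g ⁻¹' Iic c) := hTc.inter (isClosed_Iic.preimage hg)
  have hR : IsClosed (T ∩ g ⁻¹' Ici c) := hTc.inter (isClosed_Ici.preimage hg)
  rw [isPreconnected_iff_subset_of_fully_disjoint_closed hS]
  rw [isPreconnected_iff_subset_of_fully_disjoint_closed hTc] at hT
  have key : ∀ u v : Set X, IsClosed u → IsClosed v → T ∩ g ⁻¹' Iic c ⊆ u ∪ v → Disjoint u v →
      (∀ z ∈ T ∩ v, g z ≠ c) → T ∩ g ⁻¹' Iic c ⊆ u ∨ T ∩ g ⁻¹' Iic c ⊆ v := by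
    intro u v hu hv huv hd hz
    have hd' := Set.disjoint_left.1 hd
    have hcov : T ⊆ ((u ∩ (T ∩ g ⁻¹' Iic c)) ∪ (T ∩ g ⁻¹' Ici c)) ∪ (v ∩ (T ∩ g ⁻¹' Iic c)) := by
      intro x hxT
      rcases le_total (g x) c with h | h
      · rcases huv ⟨hxT, h⟩ with h2 | h2
        · exact Or.inl (Or.inl ⟨h2, hxT, h⟩)
        · exact Or.inr ⟨h2, hxT, h⟩
      · exact Or.inl (Or.inr ⟨hxT, h⟩)
    have hdisj : Disjoint ((u ∩ (T ∩ g ⁻¹' Iic c)) ∪ (T ∩ g ⁻¹' Ici c))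
        (v ∩ (T ∩ g ⁻¹' Iic c)) := by
      rw [Set.disjoint_left]
      rintro x (h1 | h1) h2
      · exact hd' h1.1 h2.1
      · exact hz x ⟨h1.1, h2.1⟩ (le_antisymm h2.2.2 h1.2)
    rcases hT _ _ ((hu.inter hS).union hR) (hv.inter hS) hcov hdisj with h | h
    · left
      rintro x ⟨hxT, hx⟩
      rcases h hxT with h1 | h1
      · exact h1.1
      · rcases huv ⟨hxT, hx⟩ with h2 | h2
        · exact h2
        · exact absurd (le_antisymm hx h1.2) (hz x ⟨hxT, h2⟩)
    · exact Or.inr fun x hx => (h hx.1).1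
  intro u v hu hv huv hd
  by_cases h : ∀ z ∈ T ∩ v, g z ≠ c
  · exact key u v hu hv huv hd h
  · push Not at h
    obtain ⟨z, hz, hzc⟩ := h
    refine (key v u hv hu (by rwa [union_comm]) hd.symm ?_).symm
    intro z' hz' hzc'
    have : z' = z := hc hzc' hzc
    subst this
    exact Set.disjoint_left.1 hd hz'.2 hz.2

theorem isPreconnected_inter_preimage_Ici {X : Type*} [TopologicalSpace X] {T : Set X} {g : X → ℝ}
    {c : ℝ} (hT : IsPreconnected T) (hTc : IsClosed T) (hg : Continuous g)
    (hc : (g ⁻¹' {c}).Subsingleton) : IsPreconnected (T ∩ g ⁻¹' Ici c) := by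
  have := isPreconnected_inter_preimage_Iic (c := -c) hT hTc hg.neg ?_
  · convert this using 2
    ext x
    simp
  · intro x hx z hz
    exact hc (neg_injective hx) (neg_injective hz)

theorem IsPreconnected.ofReal_abs_sub_le_volume_image {X : Type*} [TopologicalSpace X] {S : Set X}
    (hS : IsPreconnected S) {h : X → ℝ} (hh : ContinuousOn h S) {x x' : X} (hx : x ∈ S)
    (hx' : x' ∈ S) : ENNReal.ofReal |h x - h x'| ≤ volume (h '' S) := by
  have h1 : uIcc (h x') (h x) ⊆ h '' S :=
    (hS.image h hh).ordConnected.uIcc_subset (mem_image_of_mem h hx') (mem_image_of_mem h hx)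
  calc ENNReal.ofReal |h x - h x'| = volume (uIcc (h x') (h x)) := by
        rw [Real.volume_interval]
    _ ≤ _ := measure_mono h1

namespace MetricGraphOn

variable {X : Type} [MetricSpace X]

/-- `h` is `1`-Lipschitz along every edge. -/
def EdgeLipschitz (G : MetricGraphOn X) (h : X → ℝ) : Prop :=
  ∀ e, ∀ s ∈ Icc 0 (G.len e), ∀ t ∈ Icc 0 (G.len e),
    |h (G.edgeMap e s) - h (G.edgeMap e t)| ≤ |s - t|

theorem edgeLipschitz_dist (G : MetricGraphOn X) (x : X) : G.EdgeLipschitz (fun z => dist x z) := by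
  intro e s hs t ht
  refine le_trans ?_ (G.dist_le e s hs t ht)
  have := abs_dist_sub_le (G.edgeMap e s) (G.edgeMap e t) x
  simpa [dist_comm] using this

theorem image_eq_iUnion (G : MetricGraphOn X) (h : X → ℝ) (S : Set X) :
    h '' S = ⋃ e, (h ∘ G.edgeMap e) '' (Icc 0 (G.len e) ∩ G.edgeMap e ⁻¹' S) := by
  ext r
  simp only [mem_image, mem_iUnion, mem_inter_iff, mem_preimage, Function.comp]
  constructor
  · rintro ⟨x, hx, rfl⟩
    obtain ⟨e, t, ht, rfl⟩ := G.cover x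
    exact ⟨e, t, ⟨ht, hx⟩, rfl⟩
  · rintro ⟨e, t, ⟨_, hx⟩, rfl⟩
    exact ⟨_, hx, rfl⟩

/-- A continuous function on a connected graph has total oscillation bounded by the sum of its
oscillations along the edges. -/
theorem abs_sub_le_tsum (G : MetricGraphOn X) [ConnectedSpace X] {H : X → ℝ} (hH : Continuous H)
    {v : G.E → ℝ} (hv0 : ∀ e, 0 ≤ v e) (hv : Summable v)
    (hHv : ∀ e, ∀ s ∈ Icc 0 (G.len e), ∀ t ∈ Icc 0 (G.len e),
      |H (G.edgeMap e s) - H (G.edgeMap e t)| ≤ v e) (x x' : X) :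
    |H x - H x'| ≤ ∑' e, v e := by
  have := G.countableE
  rw [← ENNReal.ofReal_le_ofReal_iff (tsum_nonneg hv0), ENNReal.ofReal_tsum_of_nonneg hv0 hv]
  calc ENNReal.ofReal |H x - H x'| ≤ volume (H '' univ) :=
        isPreconnected_univ.ofReal_abs_sub_le_volume_image hH.continuousOn (mem_univ _) (mem_univ _)
    _ ≤ ∑' e, volume ((H ∘ G.edgeMap e) '' (Icc 0 (G.len e) ∩ G.edgeMap e ⁻¹' univ)) := by
        rw [G.image_eq_iUnion]
        exact measure_iUnion_le _
    _ ≤ _ := by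
        refine ENNReal.tsum_le_tsum fun e => (Real.volume_le_diam _).trans ?_
        refine Metric.ediam_le ?_
        rintro _ ⟨s, hs, rfl⟩ _ ⟨t, ht, rfl⟩
        rw [edist_dist, Real.dist_eq]
        exact ENNReal.ofReal_le_ofReal (hHv e s hs.1 t ht.1)

/-- The arc-length measure of a metric graph. -/
noncomputable def lengthMeasure (G : MetricGraphOn X) [MeasurableSpace X] : Measure X :=
  Measure.sum fun e => (volume.restrict (Icc 0 (G.len e))).map (G.edgeMap e)

theorem aemeasurable_edgeMap (G : MetricGraphOn X) [MeasurableSpace X] [BorelSpace X] (e : G.E) :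
    AEMeasurable (G.edgeMap e) (volume.restrict (Icc 0 (G.len e))) :=
  (G.edgeMap_cont e).aemeasurable measurableSet_Icc

theorem lengthMeasure_apply (G : MetricGraphOn X) [MeasurableSpace X] [BorelSpace X] {S : Set X}
    (hS : MeasurableSet S) :
    G.lengthMeasure S = ∑' e, volume (Icc 0 (G.len e) ∩ G.edgeMap e ⁻¹' S) := by
  rw [lengthMeasure, Measure.sum_apply _ hS]
  refine tsum_congr fun e => ?_
  rw [Measure.map_apply_of_aemeasurable (G.aemeasurable_edgeMap e) hS,
    Measure.restrict_apply' measurableSet_Icc, inter_comm]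

theorem lengthMeasure_univ (G : MetricGraphOn X) [MeasurableSpace X] [BorelSpace X]
    (hsum : Summable G.len) : G.lengthMeasure univ = ENNReal.ofReal (∑' e, G.len e) := by
  rw [G.lengthMeasure_apply MeasurableSet.univ,
    ENNReal.ofReal_tsum_of_nonneg (fun e => (G.len_pos e).le) hsum]
  simp

theorem EdgeLipschitz.volume_image_le {G : MetricGraphOn X} [MeasurableSpace X] [BorelSpace X]
    {h : X → ℝ} (hh : G.EdgeLipschitz h) {S : Set X} (hS : MeasurableSet S) :
    volume (h '' S) ≤ G.lengthMeasure S := by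
  have := G.countableE
  rw [G.lengthMeasure_apply hS, G.image_eq_iUnion]
  refine (measure_iUnion_le _).trans (ENNReal.tsum_le_tsum fun e => ?_)
  have hL : LipschitzOnWith 1 (h ∘ G.edgeMap e) (Icc 0 (G.len e) ∩ G.edgeMap e ⁻¹' S) := by
    refine LipschitzOnWith.of_dist_le_mul fun s hs t ht => ?_
    simpa [Real.dist_eq] using hh e s hs.1 t ht.1
  simpa [hausdorffMeasure_real] using hL.hausdorffMeasure_image_le (d := 1) zero_le_one

theorem secondCountableTopology (G : MetricGraphOn X) : SecondCountableTopology X := by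
  have := G.countableE
  have h : (univ : Set X) = ⋃ e, G.edgeMap e '' Icc 0 (G.len e) := by
    ext x
    obtain ⟨e, t, ht, rfl⟩ := G.cover x
    simp only [mem_univ, mem_iUnion, true_iff]
    exact ⟨e, t, ht, rfl⟩
  have hs : TopologicalSpace.IsSeparable (univ : Set X) := by
    rw [h]
    exact .iUnion fun e => (isCompact_Icc.image_of_continuousOn (G.edgeMap_cont e)).isSeparable
  have := TopologicalSpace.isSeparable_univ_iff.1 hs
  exact UniformSpace.secondCountable_of_separable X

theorem measurableSet_image_of_isClosed (G : MetricGraphOn X) {g : X → ℝ} (hg : Continuous g)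
    {S : Set X} (hS : IsClosed S) : MeasurableSet (g '' S) := by
  have := G.countableE
  rw [G.image_eq_iUnion]
  refine MeasurableSet.iUnion fun e => IsCompact.measurableSet ?_
  have hc : ContinuousOn (G.edgeMap e) (Icc 0 (G.len e)) := G.edgeMap_cont e
  refine IsCompact.image_of_continuousOn ?_
    (hg.comp_continuousOn (hc.mono inter_subset_left))
  exact isCompact_Icc.of_isClosed_subset (hc.preimage_isClosed_of_isClosed isClosed_Icc hS)
    inter_subset_left

section Unrolling

variable {G : MetricGraphOn X} {L : ℝ} {g : X → ℝ}

/-- An edgewise `1`-Lipschitz function onto an interval of length `L` pushes the arc-length measure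
of a graph of total length `L` forward to Lebesgue measure. -/
theorem map_lengthMeasure_eq [MeasurableSpace X] [BorelSpace X] (hsum : Summable G.len)
    (hL : L = ∑' e, G.len e) (hg : Continuous g) (hlip : G.EdgeLipschitz g)
    (hsurj : Ioo 0 L ⊆ range g) :
    G.lengthMeasure.map g = volume.restrict (Icc 0 L) := by
  symm
  apply Measure.eq_of_le_of_measure_univ_eq
  · refine Measure.le_iff.2 fun J hJ => ?_
    rw [Measure.restrict_congr_set Ioo_ae_eq_Icc.symm, Measure.restrict_apply hJ,
      Measure.map_apply hg.measurable hJ]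
    refine le_trans (measure_mono ?_) (hlip.volume_image_le (hg.measurable hJ))
    rintro r ⟨hr, hr'⟩
    obtain ⟨x, rfl⟩ := hsurj hr'
    exact ⟨x, hr, rfl⟩
  · rw [Measure.map_apply hg.measurable MeasurableSet.univ, preimage_univ,
      G.lengthMeasure_univ hsum, ← hL]
    simp

theorem volume_setOf_not_subsingleton_preimage (hsum : Summable G.len) (hL : L = ∑' e, G.len e)
    (hg : Continuous g) (hlip : G.EdgeLipschitz g) (hsurj : Ioo 0 L ⊆ range g) :
    volume {c | ¬ (g ⁻¹' {c}).Subsingleton} = 0 := by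
  borelize X
  have := G.secondCountableTopology
  obtain ⟨b, hbc, -, hb⟩ := TopologicalSpace.exists_countable_basis X
  have hB : ∀ B ∈ b, volume (g '' B ∩ g '' Bᶜ) = 0 := by
    intro B hBb
    have hBo := hb.isOpen hBb
    have h1 := measure_union_add_inter (μ := volume) (g '' B)
      (G.measurableSet_image_of_isClosed hg hBo.isClosed_compl)
    have h2 : volume (g '' B) + volume (g '' Bᶜ) ≤ ENNReal.ofReal L := by
      refine (add_le_add (hlip.volume_image_le hBo.measurableSet)
        (hlip.volume_image_le hBo.measurableSet.compl)).trans ?_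
      rw [measure_add_measure_compl hBo.measurableSet, G.lengthMeasure_univ hsum, hL]
    have h3 : ENNReal.ofReal L ≤ volume (g '' B ∪ g '' Bᶜ) := by
      rw [← image_union, union_compl_self, image_univ]
      simpa using measure_mono (μ := volume) hsurj
    rw [← h1] at h2
    have h4 := h2.trans h3
    have hfin : volume (g '' B ∪ g '' Bᶜ) ≠ ∞ :=
      ((le_self_add.trans h2).trans_lt ENNReal.ofReal_lt_top).ne
    by_contra h
    exact absurd h4 (not_le.2 (ENNReal.lt_add_right hfin h))
  refine measure_mono_null ?_ ((measure_biUnion_null_iff hbc).2 hB)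
  intro c hc
  simp only [mem_ofPred_eq, Set.Subsingleton, mem_preimage, mem_singleton_iff] at hc
  push Not at hc
  obtain ⟨z, hz, z', hz', hne⟩ := hc
  obtain ⟨B, hBb, hzB, hBsub⟩ := hb.exists_subset_of_mem_open (show z ∈ ({z'}ᶜ : Set X) from hne)
    isOpen_compl_singleton
  simp only [mem_iUnion]
  exact ⟨B, hBb, ⟨z, hzB, hz⟩, ⟨z', fun h => hBsub h rfl, hz'⟩⟩

theorem exists_subsingleton_preimage (hsum : Summable G.len) (hL : L = ∑' e, G.len e)
    (hg : Continuous g) (hlip : G.EdgeLipschitz g) (hsurj : Ioo 0 L ⊆ range g) {a b : ℝ}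
    (hab : a < b) : ∃ c ∈ Ioo a b, (g ⁻¹' {c}).Subsingleton := by
  by_contra! h
  have : volume (Ioo a b) ≤ 0 := by
    rw [← volume_setOf_not_subsingleton_preimage hsum hL hg hlip hsurj]
    exact measure_mono fun c hc => not_subsingleton_iff.2 (h c hc)
  simp [hab.not_ge] at this

/-- An edgewise `1`-Lipschitz function onto an interval of length `L` is an isometry when the graph
is connected of total length `L`. -/
theorem dist_eq_abs_sub [ConnectedSpace X] (hsum : Summable G.len) (hL : L = ∑' e, G.len e)
    (hg : Continuous g) (hlip : G.EdgeLipschitz g) (hsurj : Ioo 0 L ⊆ range g) (x x' : X) :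
    dist x x' = |g x - g x'| := by
  borelize X
  apply le_antisymm
  · wlog hle : g x ≤ g x' generalizing x x'
    · rw [dist_comm, abs_sub_comm]
      exact this x' x (le_of_not_ge hle)
    refine le_of_forall_pos_le_add fun ε hε => ?_
    obtain ⟨c, hc, hcs⟩ := exists_subsingleton_preimage hsum hL hg hlip hsurj
      (show g x - ε / 2 < g x by linarith)
    obtain ⟨c', hc', hcs'⟩ := exists_subsingleton_preimage hsum hL hg hlip hsurj
      (show g x' < g x' + ε / 2 by linarith)
    have h1 := isPreconnected_inter_preimage_Iic isPreconnected_univ isClosed_univ hg hcs'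
    have h1c : IsClosed (univ ∩ g ⁻¹' Iic c') := isClosed_univ.inter (isClosed_Iic.preimage hg)
    have h2 := isPreconnected_inter_preimage_Ici h1 h1c hg hcs
    have hS : univ ∩ g ⁻¹' Iic c' ∩ g ⁻¹' Ici c = g ⁻¹' Icc c c' := by
      ext z
      simp [and_comm]
    rw [hS] at h2
    have h3 := h2.ofReal_abs_sub_le_volume_image (h := fun z => dist x z) (x := x') (x' := x)
      (by fun_prop) ⟨by linarith [hc.2], hc'.1.le⟩ ⟨hc.2.le, by linarith [hc'.1]⟩
    have hm : MeasurableSet (g ⁻¹' Icc c c') := hg.measurable measurableSet_Icc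
    have h4 := h3.trans ((G.edgeLipschitz_dist x).volume_image_le hm)
    rw [← Measure.map_apply hg.measurable measurableSet_Icc,
      map_lengthMeasure_eq hsum hL hg hlip hsurj] at h4
    have h5 := (h4.trans (Measure.restrict_apply_le _ _)).trans_eq Real.volume_Icc
    rw [ENNReal.ofReal_le_ofReal_iff (by linarith [hc.2, hc'.1])] at h5
    simp only [dist_self, sub_zero, abs_of_nonneg dist_nonneg] at h5
    rw [abs_sub_comm, abs_of_nonneg (by linarith)]
    linarith [hc.1, hc'.2]
  · rw [abs_sub_le_iff]
    exact ⟨G.dist_ge g hg hlip x x', dist_comm x x' ▸ G.dist_ge g hg hlip x' x⟩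

end Unrolling

end MetricGraphOn

section Calculus

theorem abs_sub_le_setIntegral_abs_deriv {W D : ℝ → ℝ} {l : ℝ} (hW : ContinuousOn W (Icc 0 l))
    (hD : ContinuousOn D (Icc 0 l)) (hder : ∀ t ∈ Ioo 0 l, HasDerivAt W (D t) t) {s t : ℝ}
    (hs : s ∈ Icc 0 l) (ht : t ∈ Icc 0 l) : |W s - W t| ≤ ∫ r in Ioo 0 l, |D r| := by
  wlog hst : s ≤ t generalizing s t
  · rw [abs_sub_comm]
    exact this ht hs (le_of_not_ge hst)
  have hsub : Icc s t ⊆ Icc 0 l := Icc_subset_Icc hs.1 ht.2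
  have hsub' : Ioo s t ⊆ Ioo 0 l := Ioo_subset_Ioo hs.1 ht.2
  have hint : IntegrableOn (fun r => |D r|) (Ioo 0 l) :=
    (hD.abs.integrableOn_Icc).mono_set Ioo_subset_Icc_self
  have h1 := intervalIntegral.integral_eq_sub_of_hasDerivAt_of_le hst (hW.mono hsub)
    (fun x hx => hder x (hsub' hx))
    ((hD.mono hsub).intervalIntegrable_of_Icc hst)
  rw [abs_sub_comm, ← h1, intervalIntegral.integral_of_le hst, integral_Ioc_eq_integral_Ioo]
  exact abs_integral_le_integral_abs.trans
    (setIntegral_mono_set hint (Eventually.of_forall fun _ => abs_nonneg _) hsub'.eventuallyLE)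

theorem abs_sub_le_mul_abs_sub_of_hasDerivAt {W D : ℝ → ℝ} {l C : ℝ}
    (hW : ContinuousOn W (Icc 0 l)) (hder : ∀ t ∈ Ioo 0 l, HasDerivAt W (D t) t)
    (hC : ∀ t ∈ Ioo 0 l, |D t| ≤ C) {s t : ℝ} (hs : s ∈ Icc 0 l) (ht : t ∈ Icc 0 l) :
    |W s - W t| ≤ C * |s - t| := by
  wlog hst : s ≤ t generalizing s t
  · rw [abs_sub_comm, abs_sub_comm s]
    exact this ht hs (le_of_not_ge hst)
  rcases hst.eq_or_lt with rfl | hst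
  · simp
  have hsub' : Ioo s t ⊆ Ioo 0 l := Ioo_subset_Ioo hs.1 ht.2
  obtain ⟨c, hc, hc'⟩ := exists_hasDerivAt_eq_slope W D hst
    (hW.mono (Icc_subset_Icc hs.1 ht.2)) fun x hx => hder x (hsub' hx)
  have h1 : W t - W s = D c * (t - s) := by
    rw [hc', div_mul_cancel₀ _ (sub_pos.2 hst).ne']
  rw [abs_sub_comm, h1, abs_mul, abs_sub_comm t]
  exact mul_le_mul_of_nonneg_right (hC c (hsub' hc)) (abs_nonneg _)

theorem integral_sqrt_sq_sub_sq {M : ℝ} (hM : 0 ≤ M) :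
    ∫ r in (0:ℝ)..M, √(M ^ 2 - r ^ 2) = M ^ 2 * (Real.pi / 4) := by
  rcases hM.eq_or_lt with rfl | hM
  · simp
  have h0 : ∫ x in (0:ℝ)..1, √(1 - x ^ 2) = Real.pi / 4 := by
    have hi : ∀ a b : ℝ, IntervalIntegrable (fun x : ℝ => √(1 - x ^ 2)) volume a b := fun a b =>
      (by fun_prop : Continuous fun x : ℝ => √(1 - x ^ 2)).intervalIntegrable a b
    have h1 := intervalIntegral.integral_add_adjacent_intervals (hi (-1) 0) (hi 0 1)
    have h2 : ∫ x in (-1:ℝ)..0, √(1 - x ^ 2) = ∫ x in (0:ℝ)..1, √(1 - x ^ 2) := by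
      have := intervalIntegral.integral_comp_neg (a := -1) (b := 0) fun x : ℝ => √(1 - x ^ 2)
      simpa using this
    rw [integral_sqrt_one_sub_sq, h2] at h1
    linarith
  have h := intervalIntegral.integral_comp_mul_left (a := 0) (b := 1)
    (fun r => √(M ^ 2 - r ^ 2)) hM.ne'
  have h2 : ∀ x : ℝ, √(M ^ 2 - (M * x) ^ 2) = M * √(1 - x ^ 2) := fun x => by
    rw [show M ^ 2 - (M * x) ^ 2 = M ^ 2 * (1 - x ^ 2) by ring, Real.sqrt_mul (by positivity),
      Real.sqrt_sq hM.le]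
  simp only [h2, mul_zero, mul_one, intervalIntegral.integral_const_mul, h0, smul_eq_mul] at h
  field_simp at h
  linarith

/-- A function satisfying `|w'| = k √(M² - w²)` has `k`-Lipschitz `arcsin (w / M)`. -/
theorem abs_arcsin_sub_arcsin_le {w D : ℝ → ℝ} {l k M : ℝ} (hk : 0 ≤ k) (hM : 0 < M)
    (hw : ContinuousOn w (Icc 0 l)) (hder : ∀ t ∈ Ioo 0 l, HasDerivAt w (D t) t)
    (hwM : ∀ t ∈ Icc 0 l, |w t| ≤ M) (hD : ∀ t ∈ Ioo 0 l, |D t| = k * √(M ^ 2 - w t ^ 2))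
    {s t : ℝ} (hs : s ∈ Icc 0 l) (ht : t ∈ Icc 0 l) :
    |Real.arcsin (w s / M) - Real.arcsin (w t / M)| ≤ k * |s - t| := by
  have key : ∀ θ ∈ Ioo (0:ℝ) 1,
      |Real.arcsin (θ * (w s / M)) - Real.arcsin (θ * (w t / M))| ≤ k * |s - t| := by
    intro θ hθ
    refine abs_sub_le_mul_abs_sub_of_hasDerivAt (W := fun r => Real.arcsin (θ * (w r / M)))
      (D := fun r => 1 / √(1 - (θ * (w r / M)) ^ 2) * (θ * (D r / M)))
      (l := l) ?_ ?_ ?_ hs ht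
    · exact Real.continuous_arcsin.comp_continuousOn (continuousOn_const.mul (hw.div_const M))
    · intro r hr
      have h1 : |θ * (w r / M)| < 1 := by
        rw [abs_mul, abs_div, abs_of_pos hθ.1, abs_of_pos hM]
        have : |w r| / M ≤ 1 := (div_le_one hM).2 (hwM r (Ioo_subset_Icc_self hr))
        nlinarith [hθ.1, hθ.2]
      rw [abs_lt] at h1
      exact (Real.hasDerivAt_arcsin h1.1.ne' h1.2.ne).comp r
        (((hder r hr).div_const M).const_mul θ)
    · intro r hr
      have hv : (w r / M) ^ 2 ≤ 1 := by
        rw [sq_le_one_iff_abs_le_one, abs_div, abs_of_pos hM]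
        exact (div_le_one hM).2 (hwM r (Ioo_subset_Icc_self hr))
      have h2 : |D r| / M = k * √(1 - (w r / M) ^ 2) := by
        rw [hD r hr, show M ^ 2 - w r ^ 2 = M ^ 2 * (1 - (w r / M) ^ 2) by field_simp,
          Real.sqrt_mul (by positivity), Real.sqrt_sq hM.le]
        field_simp
      have hθ2 : θ ^ 2 < 1 := pow_lt_one₀ hθ.1.le hθ.2 two_ne_zero
      have h3 : √(1 - (w r / M) ^ 2) ≤ √(1 - (θ * (w r / M)) ^ 2) := by
        apply Real.sqrt_le_sqrt
        rw [mul_pow]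
        nlinarith [sq_nonneg (w r / M), hθ2]
      have h4 : 0 < √(1 - (θ * (w r / M)) ^ 2) := by
        apply Real.sqrt_pos.2
        rw [mul_pow]
        nlinarith [sq_nonneg (w r / M), hθ2]
      rw [abs_mul, abs_mul, abs_div, abs_div, abs_of_pos hθ.1, abs_of_pos hM, h2, abs_of_pos h4,
        abs_one, one_div_mul_eq_div, div_le_iff₀ h4]
      calc θ * (k * √(1 - (w r / M) ^ 2)) ≤ 1 * (k * √(1 - (w r / M) ^ 2)) :=
            mul_le_mul_of_nonneg_right hθ.2.le (by positivity)
        _ ≤ k * √(1 - (θ * (w r / M)) ^ 2) := by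
            rw [one_mul]
            exact mul_le_mul_of_nonneg_left h3 hk
  have hc : Continuous fun θ : ℝ =>
      |Real.arcsin (θ * (w s / M)) - Real.arcsin (θ * (w t / M))| := by fun_prop
  have hlim : Tendsto (fun θ : ℝ =>
      |Real.arcsin (θ * (w s / M)) - Real.arcsin (θ * (w t / M))|) (nhdsWithin 1 (Iio 1))
      (nhds |Real.arcsin (1 * (w s / M)) - Real.arcsin (1 * (w t / M))|) :=
    (hc.tendsto 1).mono_left nhdsWithin_le_nhds
  rw [one_mul, one_mul] at hlim
  refine le_of_tendsto hlim ?_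
  filter_upwards [Ioo_mem_nhdsLT (zero_lt_one' ℝ)] with θ hθ using key θ hθ

/-- If `w = c sin (k ψ)` with `ψ` a `1`-Lipschitz function, then `|w'| ≤ |c k cos (k ψ)|`. -/
theorem abs_deriv_sin_comp_le {w ψ : ℝ → ℝ} {l c k D : ℝ} (hk : 0 ≤ k)
    (hψ : ∀ s ∈ Icc 0 l, ∀ t ∈ Icc 0 l, |ψ s - ψ t| ≤ |s - t|)
    (hw : ∀ t ∈ Icc 0 l, w t = c * Real.sin (k * ψ t)) {t : ℝ} (ht : t ∈ Ioo 0 l)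
    (hD : HasDerivAt w D t) : |D| ≤ |c| * k * |Real.cos (k * ψ t)| := by
  have htI := Ioo_subset_Icc_self ht
  have hψc : ContinuousAt ψ t := by
    have : ContinuousOn ψ (Icc 0 l) := by
      refine (LipschitzOnWith.of_dist_le_mul (K := 1) fun s hs t ht => ?_).continuousOn
      simpa [Real.dist_eq] using hψ s hs t ht
    exact this.continuousAt (Icc_mem_nhds ht.1 ht.2)
  have h1 := (hasDerivAt_iff_tendsto_slope.1 hD).abs
  have h2 : Tendsto (fun s => |c| * k * |Real.cos ((k * ψ s + k * ψ t) / 2)|)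
      (nhdsWithin t {t}ᶜ) (nhds (|c| * k * |Real.cos (k * ψ t)|)) := by
    have h3 : ContinuousAt (fun s => |c| * k * |Real.cos ((k * ψ s + k * ψ t) / 2)|) t := by
      fun_prop
    have h4 := h3.tendsto
    rw [show (k * ψ t + k * ψ t) / 2 = k * ψ t by ring] at h4
    exact h4.mono_left nhdsWithin_le_nhds
  refine le_of_tendsto_of_tendsto h1 h2 ?_
  filter_upwards [mem_nhdsWithin_of_mem_nhds (Icc_mem_nhds ht.1 ht.2), self_mem_nhdsWithin]
    with s hs hne
  have hpos : 0 < |s - t| := abs_pos.2 (sub_ne_zero.2 hne)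
  rw [slope_def_field, hw s hs, hw t htI, abs_div, div_le_iff₀ hpos, ← mul_sub,
    Real.sin_sub_sin, abs_mul, abs_mul, abs_mul, abs_two]
  have h5 : |Real.sin ((k * ψ s - k * ψ t) / 2)| ≤ k * |s - t| / 2 := by
    refine (Real.abs_sin_le_abs).trans ?_
    rw [← mul_sub, abs_div, abs_mul, abs_of_nonneg hk, abs_two]
    have := hψ s hs t htI
    gcongr
  calc |c| * (2 * |Real.sin ((k * ψ s - k * ψ t) / 2)| * |Real.cos ((k * ψ s + k * ψ t) / 2)|)
      ≤ |c| * (2 * (k * |s - t| / 2) * |Real.cos ((k * ψ s + k * ψ t) / 2)|) := by gcongr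
    _ = _ := by ring

end Calculus

namespace MetricGraphOn

variable {X : Type} [MetricSpace X]

theorem exists_edgeDeriv_eqOn (G : MetricGraphOn X) {f : X → ℝ} {e : G.E}
    (hC1 : ContDiffOn ℝ 1 (f ∘ G.edgeMap e) (Icc 0 (G.len e))) :
    ∃ D : ℝ → ℝ, ContinuousOn D (Icc 0 (G.len e)) ∧ EqOn (G.edgeDeriv f e) D (Ioo 0 (G.len e)) ∧
      ∀ t ∈ Ioo 0 (G.len e), HasDerivAt (f ∘ G.edgeMap e) (D t) t := by
  have heq : EqOn (G.edgeDeriv f e) (derivWithin (f ∘ G.edgeMap e) (Icc 0 (G.len e)))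
      (Ioo 0 (G.len e)) := fun t ht => (derivWithin_of_mem_nhds (Icc_mem_nhds ht.1 ht.2)).symm
  refine ⟨_, hC1.continuousOn_derivWithin (uniqueDiffOn_Icc (G.len_pos e)) le_rfl, heq,
    fun t ht => ?_⟩
  rw [← heq ht]
  exact ((hC1.differentiableOn one_ne_zero).differentiableAt
    (Icc_mem_nhds ht.1 ht.2)).hasDerivAt

theorem edgeMass_nonneg (G : MetricGraphOn X) (f : X → ℝ) (e : G.E) : 0 ≤ G.edgeMass f e :=
  setIntegral_nonneg measurableSet_Ioo fun _ _ => sq_nonneg _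

theorem edgeEnergy_nonneg (G : MetricGraphOn X) (f : X → ℝ) (e : G.E) : 0 ≤ G.edgeEnergy f e :=
  setIntegral_nonneg measurableSet_Ioo fun _ _ => sq_nonneg _

theorem l2normSq_eq_tsum (G : MetricGraphOn X) (f : X → ℝ) :
    G.l2normSq f = ∑' e, G.edgeMass f e := tsum_univ (G.edgeMass f)

theorem derivNormSq_eq_tsum (G : MetricGraphOn X) (f : X → ℝ) :
    G.derivNormSq f = ∑' e, G.edgeEnergy f e := tsum_univ (G.edgeEnergy f)

theorem MemH1.summable_edgeMass_add_edgeEnergy {G : MetricGraphOn X} {f : X → ℝ}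
    (hf : G.MemH1 f) : Summable fun e => G.edgeMass f e + G.edgeEnergy f e := by
  have := hf.2.2.2.2
  rw [← (Equiv.Set.univ G.E).symm.summable_iff] at *
  exact this

theorem MemH1.summable_edgeMass {G : MetricGraphOn X} {f : X → ℝ} (hf : G.MemH1 f) :
    Summable (G.edgeMass f) :=
  hf.summable_edgeMass_add_edgeEnergy.of_nonneg_of_le (G.edgeMass_nonneg f)
    fun e => le_add_of_nonneg_right (G.edgeEnergy_nonneg f e)

theorem MemH1.summable_edgeEnergy {G : MetricGraphOn X} {f : X → ℝ} (hf : G.MemH1 f) :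
    Summable (G.edgeEnergy f) :=
  hf.summable_edgeMass_add_edgeEnergy.of_nonneg_of_le (G.edgeEnergy_nonneg f)
    fun e => le_add_of_nonneg_left (G.edgeMass_nonneg f e)

theorem comap_coe_nhds_neBot (y : UniformSpace.Completion X) :
    (comap ((↑) : X → UniformSpace.Completion X) (nhds y)).NeBot :=
  UniformSpace.Completion.isDenseInducing_coe.comap_nhds_neBot y

/-- A continuous function vanishing at a point of the completion is bounded by the sum of its
oscillations along the edges. -/
theorem abs_le_tsum_of_vanishesAt (G : MetricGraphOn X) [ConnectedSpace X] {H : X → ℝ}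
    (hH : Continuous H) {y : UniformSpace.Completion X} (hy : VanishesAt H y)
    {v : G.E → ℝ} (hv0 : ∀ e, 0 ≤ v e) (hv : Summable v)
    (hHv : ∀ e, ∀ s ∈ Icc 0 (G.len e), ∀ t ∈ Icc 0 (G.len e),
      |H (G.edgeMap e s) - H (G.edgeMap e t)| ≤ v e) (x : X) :
    |H x| ≤ ∑' e, v e := by
  have := comap_coe_nhds_neBot y
  have h : Tendsto (fun z => |H x - H z|) (comap ((↑) : X → UniformSpace.Completion X) (nhds y))
      (nhds |H x - 0|) := (tendsto_const_nhds.sub hy).abs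
  rw [sub_zero] at h
  exact le_of_tendsto h (Eventually.of_forall fun z => G.abs_sub_le_tsum hH hv0 hv hHv x z)

theorem MemH1.bddAbove_range_abs {G : MetricGraphOn X} [ConnectedSpace X] {f : X → ℝ}
    (hf : G.MemH1 f) (hsum : Summable G.len)
    (hC1 : ∀ e : G.E, ContDiffOn ℝ 1 (f ∘ G.edgeMap e) (Icc 0 (G.len e)))
    {y : UniformSpace.Completion X} (hy : VanishesAt f y) :
    BddAbove (range fun x => |f x|) := by
  refine ⟨∑' e, (G.len e + G.edgeEnergy f e), ?_⟩
  rintro _ ⟨x, rfl⟩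
  refine G.abs_le_tsum_of_vanishesAt hf.1 hy
    (fun e => add_nonneg (G.len_pos e).le (G.edgeEnergy_nonneg f e))
    (hsum.add hf.summable_edgeEnergy) ?_ x
  intro e s hs t ht
  obtain ⟨D, hD, heq, hder⟩ := G.exists_edgeDeriv_eqOn (hC1 e)
  refine (abs_sub_le_setIntegral_abs_deriv (hC1 e).continuousOn hD hder hs ht).trans ?_
  have hi : ∀ {u : ℝ → ℝ}, ContinuousOn u (Icc 0 (G.len e)) → IntegrableOn u (Ioo 0 (G.len e)) :=
    fun hu => hu.integrableOn_Icc.mono_set Ioo_subset_Icc_self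
  have h1 : G.len e + G.edgeEnergy f e = ∫ r in Ioo 0 (G.len e), (1 + D r ^ 2) := by
    have h2 : G.edgeEnergy f e = ∫ r in Ioo 0 (G.len e), D r ^ 2 :=
      setIntegral_congr_fun measurableSet_Ioo fun r hr => by simp only [heq hr]
    have hi2 : IntegrableOn (fun r => D r ^ 2) (Ioo 0 (G.len e)) := hi (hD.pow 2)
    rw [integral_add (hi continuousOn_const) hi2, h2]
    simp [(G.len_pos e).le]
  rw [h1]
  refine setIntegral_mono (hi hD.abs) (hi (continuousOn_const.add (hD.pow 2))) fun r => ?_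
  simp only
  nlinarith [sq_abs (D r), sq_nonneg (|D r| - 1)]

/-- The deficit of `f` on an edge in the pointwise inequality
`2 k √(M² - f²) |f'| ≤ |f'|² + k² (M² - f²)`. -/
noncomputable def edgeDeficit (G : MetricGraphOn X) (f : X → ℝ) (k M : ℝ) (e : G.E) : ℝ :=
  ∫ t in Ioo 0 (G.len e), (|G.edgeDeriv f e t| - k * √(M ^ 2 - f (G.edgeMap e t) ^ 2)) ^ 2

theorem edgeDeficit_nonneg (G : MetricGraphOn X) (f : X → ℝ) (k M : ℝ) (e : G.E) :
    0 ≤ G.edgeDeficit f k M e :=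
  setIntegral_nonneg measurableSet_Ioo fun _ _ => sq_nonneg _

section Friedlander

variable {G : MetricGraphOn X} {f : X → ℝ} {k M L : ℝ} {y : UniformSpace.Completion X}

theorem edgeDeficit_eq {e : G.E} (hC1 : ContDiffOn ℝ 1 (f ∘ G.edgeMap e) (Icc 0 (G.len e)))
    (hM : ∀ x, |f x| ≤ M) :
    G.edgeDeficit f k M e = G.edgeEnergy f e + k ^ 2 * (M ^ 2 * G.len e - G.edgeMass f e) -
      2 * ∫ t in Ioo 0 (G.len e), k * √(M ^ 2 - f (G.edgeMap e t) ^ 2) * |G.edgeDeriv f e t| := by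
  obtain ⟨D, hD, heq, hder⟩ := G.exists_edgeDeriv_eqOn hC1
  have hw : ContinuousOn (fun t => f (G.edgeMap e t)) (Icc 0 (G.len e)) := hC1.continuousOn
  have hi : ∀ {u : ℝ → ℝ}, ContinuousOn u (Icc 0 (G.len e)) → IntegrableOn u (Ioo 0 (G.len e)) :=
    fun hu => hu.integrableOn_Icc.mono_set Ioo_subset_Icc_self
  have h1 : G.edgeDeficit f k M e = ∫ t in Ioo 0 (G.len e), ((D t ^ 2 +
      k ^ 2 * (M ^ 2 - f (G.edgeMap e t) ^ 2)) -
      2 * (k * √(M ^ 2 - f (G.edgeMap e t) ^ 2) * |D t|)) := by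
    refine setIntegral_congr_fun measurableSet_Ioo fun t ht => ?_
    have h0 : 0 ≤ M ^ 2 - f (G.edgeMap e t) ^ 2 :=
      sub_nonneg.2 (sq_le_sq' (abs_le.1 (hM _)).1 (abs_le.1 (hM _)).2)
    simp only [heq ht]
    rw [sub_sq, sq_abs, mul_pow, Real.sq_sqrt h0]
    ring
  have h2 : G.edgeEnergy f e = ∫ r in Ioo 0 (G.len e), D r ^ 2 :=
    setIntegral_congr_fun measurableSet_Ioo fun r hr => by simp only [heq hr]
  have h3 : ∫ t in Ioo 0 (G.len e), k * √(M ^ 2 - f (G.edgeMap e t) ^ 2) * |G.edgeDeriv f e t| =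
      ∫ t in Ioo 0 (G.len e), k * √(M ^ 2 - f (G.edgeMap e t) ^ 2) * |D t| :=
    setIntegral_congr_fun measurableSet_Ioo fun r hr => by simp only [heq hr]
  have hs : ContinuousOn (fun t => M ^ 2 - f (G.edgeMap e t) ^ 2) (Icc 0 (G.len e)) :=
    continuousOn_const.sub (hw.pow 2)
  have i1 : IntegrableOn (fun t => D t ^ 2) (Ioo 0 (G.len e)) := hi (hD.pow 2)
  have i2 : IntegrableOn (fun t => k ^ 2 * (M ^ 2 - f (G.edgeMap e t) ^ 2)) (Ioo 0 (G.len e)) :=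
    hi (continuousOn_const.mul hs)
  have i3 : IntegrableOn (fun t => 2 * (k * √(M ^ 2 - f (G.edgeMap e t) ^ 2) * |D t|))
      (Ioo 0 (G.len e)) :=
    hi (continuousOn_const.mul ((continuousOn_const.mul hs.sqrt).mul hD.abs))
  have i4 : IntegrableOn (fun t => f (G.edgeMap e t) ^ 2) (Ioo 0 (G.len e)) := hi (hw.pow 2)
  have i12 : IntegrableOn (fun t => D t ^ 2 + k ^ 2 * (M ^ 2 - f (G.edgeMap e t) ^ 2))
      (Ioo 0 (G.len e)) := i1.add i2
  rw [h1, h2, h3, integral_sub i12 i3, integral_add i1 i2, integral_const_mul,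
    integral_const_mul, integral_sub (hi continuousOn_const) i4, edgeMass]
  simp [(G.len_pos e).le, mul_comm]

/-- The total deficit is controlled by the deficit in Friedlander's inequality. -/
theorem summable_edgeDeficit_and_tsum_le [ConnectedSpace X] (hsum : Summable G.len)
    (hL : L = ∑' e, G.len e) (hkL : k * (2 * L) = Real.pi) (hk : 0 ≤ k) (hf : G.MemH1 f)
    (hC1 : ∀ e : G.E, ContDiffOn ℝ 1 (f ∘ G.edgeMap e) (Icc 0 (G.len e)))
    (hy : VanishesAt f y) (hM : IsLUB (range fun x => |f x|) M) :
    Summable (G.edgeDeficit f k M) ∧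
      ∑' e, G.edgeDeficit f k M e ≤ G.derivNormSq f - k ^ 2 * G.l2normSq f := by
  have hM' : ∀ x, |f x| ≤ M := fun x => hM.1 (mem_range_self x)
  obtain ⟨x₀⟩ : Nonempty X := inferInstance
  have hM0 : 0 ≤ M := (abs_nonneg _).trans (hM' x₀)
  set p : ℝ → ℝ := fun r => k * √(M ^ 2 - r ^ 2) with hp
  have hpc : Continuous p := by fun_prop
  have hp0 : ∀ r, 0 ≤ p r := fun r => by positivity
  set P : ℝ → ℝ := fun t => ∫ r in (0:ℝ)..t, p r with hP
  have hPd : ∀ t, HasDerivAt P (p t) t := fun t =>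
    intervalIntegral.integral_hasDerivAt_right (hpc.intervalIntegrable _ _)
      (hpc.stronglyMeasurableAtFilter _ _) hpc.continuousAt
  have hPc : Continuous P := continuous_iff_continuousAt.2 fun t => (hPd t).continuousAt
  have hPM : P M = k * (M ^ 2 * (Real.pi / 4)) := by
    simp only [hP, hp, intervalIntegral.integral_const_mul, integral_sqrt_sq_sub_sq hM0]
  have hP0 : P 0 = 0 := by simp [hP]
  have hPabs : ∀ r, P |r| ≤ |P r| := by
    intro r
    rcases abs_choice r with h | h <;> rw [h]
    · exact le_abs_self _
    · have : P (-r) = -P r := by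
        have h1 := intervalIntegral.integral_comp_neg (a := 0) (b := -r) p
        simp only [hp, neg_sq, neg_neg, neg_zero] at h1
        simp only [hP, hp]
        rw [h1, intervalIntegral.integral_symm]
      rw [this]
      exact neg_le_abs _
  set V : G.E → ℝ := fun e =>
    ∫ t in Ioo 0 (G.len e), k * √(M ^ 2 - f (G.edgeMap e t) ^ 2) * |G.edgeDeriv f e t| with hV
  have hV0 : ∀ e, 0 ≤ V e := fun e =>
    setIntegral_nonneg measurableSet_Ioo fun t _ => mul_nonneg (hp0 _) (abs_nonneg _)
  have hq : ∀ e, G.edgeDeficit f k M e =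
      G.edgeEnergy f e + k ^ 2 * (M ^ 2 * G.len e - G.edgeMass f e) - 2 * V e :=
    fun e => edgeDeficit_eq (hC1 e) hM'
  have hB : Summable fun e =>
      G.edgeEnergy f e + k ^ 2 * (M ^ 2 * G.len e - G.edgeMass f e) :=
    hf.summable_edgeEnergy.add (((hsum.mul_left _).sub hf.summable_edgeMass).mul_left _)
  have hVs : Summable V := by
    refine hB.of_nonneg_of_le hV0 fun e => ?_
    have := G.edgeDeficit_nonneg f k M e
    rw [hq e] at this
    linarith [hV0 e]
  have hPV : ∀ x, |P (f x)| ≤ ∑' e, V e := by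
    refine G.abs_le_tsum_of_vanishesAt (H := P ∘ f) (hPc.comp hf.1) (y := y) ?_ hV0 hVs ?_
    · have := (hPc.tendsto 0).comp hy
      rwa [hP0] at this
    · intro e s hs t ht
      obtain ⟨D, hD, heq, hder⟩ := G.exists_edgeDeriv_eqOn (hC1 e)
      have h1 := abs_sub_le_setIntegral_abs_deriv (W := P ∘ f ∘ G.edgeMap e)
        (D := fun t => p (f (G.edgeMap e t)) * D t) (l := G.len e)
        (hPc.comp_continuousOn (hC1 e).continuousOn)
        ((hpc.comp_continuousOn (hC1 e).continuousOn).mul hD)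
        (fun t ht => (hPd _).comp t (hder t ht)) hs ht
      refine h1.trans_eq (setIntegral_congr_fun measurableSet_Ioo fun r hr => ?_)
      rw [abs_mul, heq hr, abs_of_nonneg (hp0 _)]
  have hPMV : P M ≤ ∑' e, V e := by
    have h1 : M ∈ closure (range fun x => |f x|) := hM.mem_closure (range_nonempty _)
    have h2 : IsClosed {r | P r ≤ ∑' e, V e} := isClosed_le hPc continuous_const
    refine closure_minimal ?_ h2 h1
    rintro _ ⟨x, rfl⟩
    exact (hPabs _).trans (hPV x)
  have hqe : G.edgeDeficit f k M = fun e =>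
      G.edgeEnergy f e + k ^ 2 * (M ^ 2 * G.len e - G.edgeMass f e) - 2 * V e := funext hq
  refine ⟨hqe ▸ hB.sub (hVs.mul_left 2), ?_⟩
  rw [hqe, hB.tsum_sub (hVs.mul_left 2), hf.summable_edgeEnergy.tsum_add
    (((hsum.mul_left _).sub hf.summable_edgeMass).mul_left _), tsum_mul_left, tsum_mul_left,
    (hsum.mul_left _).tsum_sub hf.summable_edgeMass, tsum_mul_left, ← hL,
    ← G.derivNormSq_eq_tsum, ← G.l2normSq_eq_tsum]
  rw [hPM] at hPMV
  have h3 : k ^ 2 * (M ^ 2 * L) = 2 * (k * (M ^ 2 * (Real.pi / 4))) := by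
    rw [← hkL]
    ring
  linarith [h3]

theorem abs_edgeDeriv_eq_of_edgeDeficit_eq_zero {e : G.E}
    (hC1 : ContDiffOn ℝ 1 (f ∘ G.edgeMap e) (Icc 0 (G.len e)))
    (h : G.edgeDeficit f k M e = 0) {t : ℝ} (ht : t ∈ Ioo 0 (G.len e)) :
    |G.edgeDeriv f e t| = k * √(M ^ 2 - f (G.edgeMap e t) ^ 2) := by
  obtain ⟨D, hD, heq, -⟩ := G.exists_edgeDeriv_eqOn hC1
  have hw : ContinuousOn (fun t => f (G.edgeMap e t)) (Icc 0 (G.len e)) := hC1.continuousOn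
  have hu : ContinuousOn (fun t => (|D t| - k * √(M ^ 2 - f (G.edgeMap e t) ^ 2)) ^ 2)
      (Icc 0 (G.len e)) :=
    (hD.abs.sub (continuousOn_const.mul (continuousOn_const.sub (hw.pow 2)).sqrt)).pow 2
  have h1 : ∫ t in Ioo 0 (G.len e), (|D t| - k * √(M ^ 2 - f (G.edgeMap e t) ^ 2)) ^ 2 = 0 := by
    refine Eq.trans ?_ h
    exact setIntegral_congr_fun measurableSet_Ioo fun r hr => by simp only [heq hr]
  rw [setIntegral_eq_zero_iff_of_nonneg_ae (Eventually.of_forall fun _ => sq_nonneg _)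
    (hu.integrableOn_Icc.mono_set Ioo_subset_Icc_self)] at h1
  have h2 := Measure.eqOn_open_of_ae_eq h1 isOpen_Ioo (hu.mono Ioo_subset_Icc_self)
    continuousOn_const ht
  rw [heq ht]
  exact sub_eq_zero.1 (pow_eq_zero_iff two_ne_zero |>.1 h2)

theorem edgeLipschitz_abs_arcsin
    (hC1 : ∀ e : G.E, ContDiffOn ℝ 1 (f ∘ G.edgeMap e) (Icc 0 (G.len e)))
    (hk : 0 < k) (hM0 : 0 < M) (hM : ∀ x, |f x| ≤ M) (h : ∀ e, G.edgeDeficit f k M e = 0) :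
    G.EdgeLipschitz fun x => |Real.arcsin (f x / M)| / k := by
  intro e s hs t ht
  obtain ⟨D, -, heq, hder⟩ := G.exists_edgeDeriv_eqOn (hC1 e)
  have h1 := abs_arcsin_sub_arcsin_le hk.le hM0 (hC1 e).continuousOn hder (fun t _ => hM _)
    (fun t ht => heq ht ▸ abs_edgeDeriv_eq_of_edgeDeficit_eq_zero (hC1 e) (h e) ht) hs ht
  rw [← sub_div, abs_div, abs_of_pos hk, div_le_iff₀ hk, mul_comm]
  exact (abs_abs_sub_abs_le _ _).trans h1

theorem dist_coe_eq_of_tendsto {φ : X → ℝ} (hφ : ∀ x x', dist x x' = |φ x - φ x'|)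
    (hφ0 : ∀ x, 0 ≤ φ x) (hy : VanishesAt φ y) (x : X) :
    dist (x : UniformSpace.Completion X) y = φ x := by
  have := comap_coe_nhds_neBot y
  have h1 : Tendsto (fun z : X => dist (x : UniformSpace.Completion X) z)
      (comap ((↑) : X → UniformSpace.Completion X) (nhds y))
      (nhds (dist (x : UniformSpace.Completion X) y)) :=
    tendsto_const_nhds.dist tendsto_comap
  simp only [UniformSpace.Completion.dist_eq, hφ] at h1
  have h2 : Tendsto (fun z => |φ x - φ z|)
      (comap ((↑) : X → UniformSpace.Completion X) (nhds y)) (nhds |φ x - 0|) :=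
    (tendsto_const_nhds.sub hy).abs
  rw [sub_zero, abs_of_nonneg (hφ0 x)] at h2
  exact tendsto_nhds_unique h1 h2

/-- The rigidity part of Friedlander's lemma. -/
theorem isIntervalWithEndpoint_of_edgeDeficit_eq_zero [ConnectedSpace X] (hsum : Summable G.len)
    (hL : L = ∑' e, G.len e) (hkL : k * (2 * L) = Real.pi) (hk : 0 < k) (hfc : Continuous f)
    (hC1 : ∀ e : G.E, ContDiffOn ℝ 1 (f ∘ G.edgeMap e) (Icc 0 (G.len e)))
    (hy : VanishesAt f y) (hM : IsLUB (range fun x => |f x|) M) (hM0 : 0 < M)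
    (h : ∀ e, G.edgeDeficit f k M e = 0) :
    IsIntervalWithEndpoint X L y ∧ ∃ c : ℝ, ∀ x : X,
      f x = c * Real.sin (k * dist (x : UniformSpace.Completion X) y) := by
  have hM' : ∀ x, |f x| ≤ M := fun x => hM.1 (mem_range_self x)
  set g : X → ℝ := fun x => |Real.arcsin (f x / M)| / k with hg
  have hgc : Continuous g := by fun_prop
  have hg0 : ∀ x, 0 ≤ g x := fun x => by positivity
  have hgL : ∀ x, g x ≤ L := by
    intro x
    rw [hg, div_le_iff₀ hk, abs_le]
    have := Real.neg_pi_div_two_le_arcsin (f x / M)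
    have := Real.arcsin_le_pi_div_two (f x / M)
    constructor <;> linarith
  have hgy : VanishesAt g y := by
    have h1 : Continuous fun r : ℝ => |Real.arcsin (r / M)| / k := by fun_prop
    have h2 := (h1.tendsto 0).comp hy
    simp only [zero_div, Real.arcsin_zero, abs_zero] at h2
    exact h2
  have hne := comap_coe_nhds_neBot y
  have hsin : ∀ x, |f x| = M * Real.sin (k * g x) := by
    intro x
    have h1 := (abs_le.1 (hM' x))
    have h2 : -1 ≤ f x / M := by rw [le_div_iff₀ hM0]; linarith
    have h3 : f x / M ≤ 1 := by rw [div_le_iff₀ hM0]; linarith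
    have h4 : |f x / M| = Real.sin |Real.arcsin (f x / M)| := by
      rcases le_total 0 (f x / M) with h5 | h5
      · rw [abs_of_nonneg h5, abs_of_nonneg (Real.arcsin_nonneg.2 h5), Real.sin_arcsin h2 h3]
      · rw [abs_of_nonpos h5, abs_of_nonpos (Real.arcsin_nonpos.2 h5), Real.sin_neg,
          Real.sin_arcsin h2 h3]
    rw [show k * g x = |Real.arcsin (f x / M)| by simp only [hg]; field_simp, ← h4, abs_div,
      abs_of_pos hM0]
    field_simp
  have hsurj : Ioo 0 L ⊆ range g := by
    intro r hr
    obtain ⟨x, hx⟩ : ∃ x, g x < r := (hgy.eventually (gt_mem_nhds hr.1)).exists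
    obtain ⟨x', hx'⟩ : ∃ x', r < g x' := by
      by_contra! hcon
      have h1 : M ≤ M * Real.sin (k * r) := by
        refine hM.2 ?_
        rintro _ ⟨z, rfl⟩
        simp only [hsin z]
        refine mul_le_mul_of_nonneg_left (Real.sin_le_sin_of_le_of_le_pi_div_two ?_ ?_ ?_) hM0.le
        · nlinarith [hg0 z, Real.pi_pos]
        · nlinarith [hr.2]
        · exact mul_le_mul_of_nonneg_left (hcon z) hk.le
      have h2 : Real.sin (k * r) < Real.sin (Real.pi / 2) := by
        refine Real.sin_lt_sin_of_lt_of_le_pi_div_two ?_ le_rfl ?_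
        · nlinarith [hr.1, Real.pi_pos, mul_pos hk hr.1]
        · nlinarith [hr.2]
      rw [Real.sin_pi_div_two] at h2
      nlinarith
    exact (isPreconnected_range hgc).ordConnected.out (mem_range_self x) (mem_range_self x')
      ⟨hx.le, hx'.le⟩
  have hlip := edgeLipschitz_abs_arcsin hC1 hk hM0 hM' h
  have hiso := dist_eq_abs_sub hsum hL hgc hlip hsurj
  have hzero : ∀ x, f x = 0 → g x = 0 := fun x hx => by simp [hg, hx]
  refine ⟨⟨g, hiso, hsurj, ?_, hgy⟩, ?_⟩
  · rintro _ ⟨x, rfl⟩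
    exact ⟨hg0 x, hgL x⟩
  have hginj : Function.Injective g := fun x x' hxx' => by
    rw [← dist_eq_zero, hiso, hxx', sub_self, abs_zero]
  have hsign : (∀ x, 0 ≤ f x) ∨ ∀ x, f x ≤ 0 := by
    by_contra! hcon
    obtain ⟨⟨x, hx⟩, x', hx'⟩ := hcon
    have hpos : ∀ z, f z ≠ 0 → 0 < g z := fun z hz => by
      refine (hg0 z).lt_of_ne' fun hz' => hz ?_
      have := hsin z
      rwa [hz', mul_zero, Real.sin_zero, mul_zero, abs_eq_zero] at this
    have hconn := isPreconnected_inter_preimage_Ici (c := min (g x) (g x')) isPreconnected_univ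
      isClosed_univ hgc (subsingleton_singleton.preimage hginj)
    obtain ⟨z, hz, hz0⟩ := (hconn.image f hfc.continuousOn).ordConnected.out
      (mem_image_of_mem f ⟨mem_univ x, min_le_left (g x) (g x')⟩)
      (mem_image_of_mem f ⟨mem_univ x', min_le_right (g x) (g x')⟩) ⟨hx.le, hx'.le⟩
    have h1 : min (g x) (g x') ≤ g z := hz.2
    rw [hzero z hz0] at h1
    exact absurd h1 (not_le.2 (lt_min (hpos x hx.ne) (hpos x' hx'.ne')))
  have hd := dist_coe_eq_of_tendsto hiso hg0 hgy
  rcases hsign with hs | hs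
  · exact ⟨M, fun x => by rw [hd, ← hsin, abs_of_nonneg (hs x)]⟩
  · exact ⟨-M, fun x => by rw [hd, neg_mul, ← hsin, abs_of_nonpos (hs x), neg_neg]⟩

/-- On an interval, the first eigenfunction attains equality in Friedlander's inequality. -/
theorem derivNormSq_le_of_eq_sin (hsum : Summable G.len)
    (hL : L = ∑' e, G.len e) (hkL : k * (2 * L) = Real.pi) (hk : 0 < k) (hL0 : 0 < L)
    (hf : G.MemH1 f)
    (hC1 : ∀ e : G.E, ContDiffOn ℝ 1 (f ∘ G.edgeMap e) (Icc 0 (G.len e)))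
    {φ : X → ℝ} (hφ : ∀ x x', dist x x' = |φ x - φ x'|) (hsurj : Ioo 0 L ⊆ range φ) {c : ℝ}
    (hc : ∀ x, f x = c * Real.sin (k * φ x)) :
    G.derivNormSq f ≤ k ^ 2 * G.l2normSq f := by
  borelize X
  have hφc : Continuous φ :=
    (LipschitzWith.of_dist_le_mul (K := 1) fun x x' => by
      rw [hφ, Real.dist_eq, NNReal.coe_one, one_mul]).continuous
  have hlip : G.EdgeLipschitz φ := fun e s hs t ht => hφ _ _ ▸ G.dist_le e s hs t ht
  have hmap := map_lengthMeasure_eq hsum hL hφc hlip hsurj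
  have hint0 : ∫ x, Real.cos (2 * (k * φ x)) ∂G.lengthMeasure = 0 := by
    have h1 := integral_map (μ := G.lengthMeasure) hφc.aemeasurable
      (f := fun r => Real.cos (2 * (k * r)))
      (by fun_prop : Continuous fun r : ℝ => Real.cos (2 * (k * r))).aestronglyMeasurable
    rw [← h1, hmap, integral_Icc_eq_integral_Ioc, ← intervalIntegral.integral_of_le hL0.le]
    have h2 := intervalIntegral.integral_comp_mul_left (a := 0) (b := L) Real.cos
      (c := 2 * k) (by positivity)
    simp only [mul_assoc] at h2
    rw [h2, mul_zero, mul_zero, integral_cos, show 2 * (k * L) = Real.pi by linarith]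
    simp
  have hfin : IsFiniteMeasure G.lengthMeasure :=
    ⟨by rw [G.lengthMeasure_univ hsum]; exact ENNReal.ofReal_lt_top⟩
  have hintble : Integrable (fun x => Real.cos (2 * (k * φ x))) G.lengthMeasure :=
    Integrable.of_bound (C := 1)
      (by fun_prop : Continuous fun x => Real.cos (2 * (k * φ x))).aestronglyMeasurable
      (Eventually.of_forall fun x => Real.abs_cos_le_one _)
  have hsumcos := hasSum_integral_measure hintble
  have hedge : ∀ e, ∫ x, Real.cos (2 * (k * φ x))
      ∂((volume.restrict (Icc 0 (G.len e))).map (G.edgeMap e)) =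
      ∫ t in Ioo 0 (G.len e), Real.cos (2 * (k * φ (G.edgeMap e t))) := by
    intro e
    rw [integral_map (G.aemeasurable_edgeMap e)
      (by fun_prop : Continuous fun x => Real.cos (2 * (k * φ x))).aestronglyMeasurable,
      integral_Icc_eq_integral_Ioc, integral_Ioc_eq_integral_Ioo]
  simp only [hedge] at hsumcos
  change HasSum _ (∫ x, Real.cos (2 * (k * φ x)) ∂G.lengthMeasure) at hsumcos
  rw [hint0] at hsumcos
  have hle : ∀ e, G.edgeEnergy f e - k ^ 2 * G.edgeMass f e ≤
      c ^ 2 * k ^ 2 * ∫ t in Ioo 0 (G.len e), Real.cos (2 * (k * φ (G.edgeMap e t))) := by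
    intro e
    obtain ⟨D, hD, heq, hder⟩ := G.exists_edgeDeriv_eqOn (hC1 e)
    have hw : ContinuousOn (fun t => f (G.edgeMap e t)) (Icc 0 (G.len e)) := (hC1 e).continuousOn
    have hψ : ContinuousOn (fun t => φ (G.edgeMap e t)) (Icc 0 (G.len e)) :=
      hφc.comp_continuousOn (G.edgeMap_cont e)
    have hi : ∀ {u : ℝ → ℝ}, ContinuousOn u (Icc 0 (G.len e)) →
        IntegrableOn u (Ioo 0 (G.len e)) :=
      fun hu => hu.integrableOn_Icc.mono_set Ioo_subset_Icc_self
    have h2 : G.edgeEnergy f e = ∫ r in Ioo 0 (G.len e), D r ^ 2 :=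
      setIntegral_congr_fun measurableSet_Ioo fun r hr => by simp only [heq hr]
    have i1 : IntegrableOn (fun t => D t ^ 2) (Ioo 0 (G.len e)) := hi (hD.pow 2)
    have i2 : IntegrableOn (fun t => k ^ 2 * f (G.edgeMap e t) ^ 2) (Ioo 0 (G.len e)) :=
      hi (continuousOn_const.mul (hw.pow 2))
    rw [h2, edgeMass, ← integral_const_mul, ← integral_const_mul, ← integral_sub i1 i2]
    refine setIntegral_mono_on (i1.sub i2) (hi (continuousOn_const.mul
      (Real.continuous_cos.comp_continuousOn (continuousOn_const.mul (continuousOn_const.mul hψ)))))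
      measurableSet_Ioo fun t ht => ?_
    have h3 : |D t| ≤ |c| * k * |Real.cos (k * φ (G.edgeMap e t))| :=
      abs_deriv_sin_comp_le hk.le (hlip e) (fun t _ => hc _) ht (hder t ht)
    have h4 : D t ^ 2 ≤ (|c| * k * |Real.cos (k * φ (G.edgeMap e t))|) ^ 2 := by
      rw [← sq_abs]
      exact pow_le_pow_left₀ (abs_nonneg _) h3 2
    rw [mul_pow, mul_pow, sq_abs, sq_abs] at h4
    rw [hc, Real.cos_two_mul']
    linarith [h4]
  have h5 := (hf.summable_edgeEnergy.sub (hf.summable_edgeMass.mul_left (k ^ 2))).tsum_le_tsum hle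
    (hsumcos.summable.mul_left _)
  rw [tsum_mul_left, hsumcos.tsum_eq, mul_zero,
    hf.summable_edgeEnergy.tsum_sub (hf.summable_edgeMass.mul_left (k ^ 2)), tsum_mul_left,
    ← G.derivNormSq_eq_tsum, ← G.l2normSq_eq_tsum] at h5
  linarith

end Friedlander

end MetricGraphOn

open MetricGraphOn in
/-- Friedlander's lemma for infinite graphs. Let `G` be a locally
finite, connected metric graph of finite total length `L > 0`, let `y` be a point of
the completion of `G` (a vertex or an end), and let `f ∈ H¹(G)` vanish at `y` and be
`C¹` on each closed edge. Then `∫_G |f'|² ≥ (π²/(4L²)) ∫_G |f|²`; equality holds for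
a nonzero `f` iff `G` is isometrically isomorphic to an interval with `y` as one of
its endpoints and `f` is proportional to `sin(πs/(2L))`, `s` the distance to `y`. -/
theorem statement10 (X : Type) [MetricSpace X] (G : MetricGraphOn X)
    (hlf : G.LocallyFinite) (hconn : ConnectedSpace X)
    (hsum : Summable G.len) (L : ℝ) (hL : L = ∑' e : G.E, G.len e) (hLpos : 0 < L)
    (y : UniformSpace.Completion X) (hy : y ∈ G.vertexPoints ∪ G.Ends)
    (f : X → ℝ) (hf : G.MemH1 f)
    (hC1 : ∀ e : G.E, ContDiffOn ℝ 1 (f ∘ G.edgeMap e) (Set.Icc 0 (G.len e)))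
    (hvanish : MetricGraphOn.VanishesAt f y) :
    Real.pi ^ 2 / (4 * L ^ 2) * G.l2normSq f ≤ G.derivNormSq f ∧
    (f ≠ 0 →
      (G.derivNormSq f = Real.pi ^ 2 / (4 * L ^ 2) * G.l2normSq f ↔
        (IsIntervalWithEndpoint X L y ∧ ∃ c : ℝ, ∀ x : X,
          f x = c * Real.sin (Real.pi *
            dist ((x : UniformSpace.Completion X)) y / (2 * L))))) := by
  obtain ⟨k, hk⟩ : ∃ k, k = Real.pi / (2 * L) := ⟨_, rfl⟩
  have hkL : k * (2 * L) = Real.pi := by rw [hk]; field_simp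
  have hk0 : 0 < k := by rw [hk]; positivity
  have hk2 : Real.pi ^ 2 / (4 * L ^ 2) = k ^ 2 := by rw [hk, div_pow]; ring
  have hkd : ∀ d, Real.pi * d / (2 * L) = k * d := fun d => by rw [hk]; ring
  have hM := isLUB_csSup (range_nonempty fun x => |f x|) (hf.bddAbove_range_abs hsum hC1 hvanish)
  obtain ⟨hds, hdle⟩ := summable_edgeDeficit_and_tsum_le hsum hL hkL hk0.le hf hC1 hvanish hM
  have hd0 : 0 ≤ ∑' e, G.edgeDeficit f k (sSup (range fun x => |f x|)) e :=
    tsum_nonneg (G.edgeDeficit_nonneg f k _)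
  simp only [hk2, hkd]
  refine ⟨by linarith, fun hf0 => ⟨fun heq => ?_, ?_⟩⟩
  · obtain ⟨x, hx⟩ := Function.ne_iff.1 hf0
    refine isIntervalWithEndpoint_of_edgeDeficit_eq_zero hsum hL hkL hk0 hf.1 hC1 hvanish hM
      ((abs_pos.2 hx).trans_le (hM.1 (mem_range_self x))) fun e => ?_
    refine le_antisymm ?_ (G.edgeDeficit_nonneg _ _ _ e)
    have := hds.le_tsum e fun e' _ => G.edgeDeficit_nonneg _ _ _ e'
    linarith
  · rintro ⟨⟨φ, hφ, hsurj, hrange, hφy⟩, c, hc⟩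
    have hd := dist_coe_eq_of_tendsto hφ (fun x => (hrange (mem_range_self x)).1) hφy
    simp only [hd] at hc
    have := derivNormSq_le_of_eq_sin hsum hL hkL hk0 hLpos hf hC1 hφ hsurj hc
    linarith
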